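/- Let G be a distance-regular graph with valency k ≥ 3 and diameter D that contains a quadrangle (an induced 4-cycle). Then D ≤ 2k/(k + 1 - b_1), and hence D ≤ b_1 + 1. -/

import Mathlib

open Finset

/-- A connected simple graph `G` of diameter `D` is distance-regular with intersection
numbers `b i`, `c i` (`0 ≤ i ≤ D`, with `c 0 = 0` and `b D = 0`) if for any two vertices
`x, y` at graph distance `i`, the vertex `y` has exactly `c i` neighbors at distance
`i - 1` from `x` and exactly `b i` neighbors at distance `i + 1` from `x`. -/
def IsDistRegular {V : Type*} (G : SimpleGraph V) (D : ℕ) (b c : ℕ → ℕ) : Prop :=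
  G.Connected ∧
  (∀ x y : V, G.dist x y ≤ D) ∧
  (∃ x y : V, G.dist x y = D) ∧
  c 0 = 0 ∧ b D = 0 ∧
  ∀ i ≤ D, ∀ x y : V, G.dist x y = i →
    {z : V | G.Adj y z ∧ G.dist x z + 1 = i}.ncard = c i ∧
    {z : V | G.Adj y z ∧ G.dist x z = i + 1}.ncard = b i

/-- The Biggs potentials: `φ 0 = n - 1` and `φ i = (c i * φ (i-1) - k) / b i`,
where `k` is the valency and `n` the number of vertices. -/
noncomputable def biggsPhi (b c : ℕ → ℕ) (k n : ℕ) : ℕ → ℝ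
  | 0 => (n : ℝ) - 1
  | (i + 1) => ((c (i + 1) : ℝ) * biggsPhi b c k n i - (k : ℝ)) / (b (i + 1) : ℝ)

/-- A quadrangle in a graph: an induced cycle on 4 vertices. -/
def HasQuadrangle {V : Type*} (G : SimpleGraph V) : Prop :=
  ∃ v0 v1 v2 v3 : V,
    v0 ≠ v1 ∧ v0 ≠ v2 ∧ v0 ≠ v3 ∧ v1 ≠ v2 ∧ v1 ≠ v3 ∧ v2 ≠ v3 ∧
    G.Adj v0 v1 ∧ G.Adj v1 v2 ∧ G.Adj v2 v3 ∧ G.Adj v3 v0 ∧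
    ¬ G.Adj v0 v2 ∧ ¬ G.Adj v1 v3

namespace IsDistRegular

/-- The intersection matrix of a distance-regular graph, acting on functions of the distance. -/
noncomputable def intersectionOp (b c : ℕ → ℕ) (f : ℕ → ℝ) (i : ℕ) : ℝ :=
  c i * f (i - 1) + ((b 0 : ℝ) - b i - c i) * f i + b i * f (i + 1)

/-- The convolution of two functions of the distance. -/
noncomputable def distConv {V : Type*} [Fintype V] (G : SimpleGraph V) (g f : ℕ → ℝ)
    (x y : V) : ℝ :=
  ∑ z, g (G.dist x z) * f (G.dist y z)

/-- The number of ordered pairs of vertices at distance `j`. -/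
noncomputable def numPairs {V : Type*} [Fintype V] (G : SimpleGraph V) (j : ℕ) : ℝ :=
  ∑ x : V, ∑ y : V, (Pi.single j 1 : ℕ → ℝ) (G.dist x y)

variable {V : Type*} {G : SimpleGraph V} {D : ℕ} {b c : ℕ → ℕ}

lemma exists_adj_dist_eq (hG : G.Connected) {x y : V} {j : ℕ} (hxy : G.dist x y = j + 1) :
    ∃ z, G.Adj y z ∧ G.dist x z = j := by
  obtain ⟨p, hp⟩ := hG.exists_walk_length_eq_dist y x
  rw [SimpleGraph.dist_comm, hxy] at hp
  cases p with
  | nil => simp at hp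
  | @cons _ z _ hyz q =>
    refine ⟨z, hyz, ?_⟩
    have h1 : G.dist z x ≤ q.length := SimpleGraph.dist_le q
    have h2 : G.dist x y ≤ G.dist x z + G.dist z y := hG.dist_triangle
    have h3 : G.dist z y = 1 := SimpleGraph.dist_eq_one_iff_adj.2 hyz.symm
    rw [SimpleGraph.Walk.length_cons] at hp
    rw [SimpleGraph.dist_comm] at h1
    omega

lemma dist_le_add_one_of_adj (hG : G.Connected) (z : V) {x y : V} (hxy : G.Adj x y) :
    G.dist z y ≤ G.dist z x + 1 := by
  have h1 : G.dist z y ≤ G.dist z x + G.dist x y := hG.dist_triangle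
  rwa [SimpleGraph.dist_eq_one_iff_adj.2 hxy] at h1

lemma exists_dist_eq (h : IsDistRegular G D b c) {j : ℕ} (hj : j ≤ D) :
    ∃ x y : V, G.dist x y = j := by
  induction hj using Nat.decreasingInduction with
  | self => exact h.2.2.1
  | of_succ k _ ih =>
    obtain ⟨x, y, hxy⟩ := ih
    obtain ⟨z, -, hz⟩ := exists_adj_dist_eq h.1 hxy
    exact ⟨x, z, hz⟩

lemma dist_eq_two {x y z : V} (hG : G.Connected) (hxy : G.Adj x y) (hyz : G.Adj y z)
    (hne : x ≠ z) (hxz : ¬ G.Adj x z) : G.dist x z = 2 := by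
  have h1 := hG.one_lt_dist_of_ne_of_not_adj hne hxz
  have h2 := dist_le_add_one_of_adj hG x hyz
  rw [SimpleGraph.dist_eq_one_iff_adj.2 hxy] at h2
  omega

lemma c_one (h : IsDistRegular G D b c) (hD : 1 ≤ D) : c 1 = 1 := by
  obtain ⟨x, y, hxy⟩ := h.exists_dist_eq hD
  rw [← (h.2.2.2.2.2 1 hD x y hxy).1, Set.ncard_eq_one]
  refine ⟨x, Set.ext fun z => ?_⟩
  simp only [Set.mem_ofPred_eq, Set.mem_singleton_iff]
  constructor
  · rintro ⟨-, hz⟩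
    exact ((h.1.dist_eq_zero_iff).1 (by omega)).symm
  · rintro rfl
    exact ⟨(SimpleGraph.dist_eq_one_iff_adj.1 hxy).symm, by simp⟩

variable [Fintype V]

lemma c_succ_pos (h : IsDistRegular G D b c) {j : ℕ} (hj : j + 1 ≤ D) : 0 < c (j + 1) := by
  obtain ⟨x, y, hxy⟩ := h.exists_dist_eq hj
  obtain ⟨z, hyz, hz⟩ := exists_adj_dist_eq h.1 hxy
  rw [← (h.2.2.2.2.2 _ hj x y hxy).1, Set.ncard_pos]
  exact ⟨z, hyz, by omega⟩

lemma b_pos (h : IsDistRegular G D b c) {j : ℕ} (hj : j + 1 ≤ D) : 0 < b j := by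
  obtain ⟨x, y, hxy⟩ := h.exists_dist_eq hj
  obtain ⟨z, hyz, hz⟩ := exists_adj_dist_eq h.1 hxy
  rw [← (h.2.2.2.2.2 j (by omega) x z hz).2, Set.ncard_pos]
  exact ⟨y, hyz.symm, hxy⟩

lemma numPairs_pos (h : IsDistRegular G D b c) {j : ℕ} (hj : j ≤ D) : 0 < numPairs G j := by
  obtain ⟨x, y, hxy⟩ := h.exists_dist_eq hj
  have hnn (i : ℕ) : 0 ≤ (Pi.single j 1 : ℕ → ℝ) i := by
    rw [Pi.single_apply]; split_ifs <;> norm_num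
  refine Finset.sum_pos' (fun x _ => Finset.sum_nonneg fun y _ => hnn _) ⟨x, mem_univ x, ?_⟩
  exact Finset.sum_pos' (fun y _ => hnn _) ⟨y, mem_univ y, by simp [hxy]⟩

lemma sum_adj_ite [DecidableRel G.Adj] (p : V → Prop) [DecidablePred p] (y : V) :
    (∑ z, if G.Adj y z then (if p z then (1 : ℝ) else 0) else 0) =
      {z : V | G.Adj y z ∧ p z}.ncard := by
  rw [Set.ncard_eq_toFinset_card']
  simp [← ite_and, Finset.sum_boole]

open scoped Classical in
/-- Summing a function of the distance to `x` over the neighbors of `y`. -/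
lemma sum_adj (h : IsDistRegular G D b c) (f : ℕ → ℝ) (x y : V) :
    (∑ z, if G.Adj y z then f (G.dist x z) else 0) = intersectionOp b c f (G.dist x y) := by
  set i := G.dist x y with hi
  have key (z : V) : (if G.Adj y z then f (G.dist x z) else 0) =
      f (i - 1) * (if G.Adj y z then (if G.dist x z + 1 = i then 1 else 0) else 0) +
      f (i + 1) * (if G.Adj y z then (if G.dist x z = i + 1 then 1 else 0) else 0) +
      f i * ((if G.Adj y z then (if G.dist y z = 0 + 1 then 1 else 0) else 0) -
        (if G.Adj y z then (if G.dist x z + 1 = i then 1 else 0) else 0) -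
        (if G.Adj y z then (if G.dist x z = i + 1 then 1 else 0) else 0)) := by
    by_cases hyz : G.Adj y z
    · have h1 := dist_le_add_one_of_adj h.1 x hyz
      have h2 := dist_le_add_one_of_adj h.1 x hyz.symm
      have h3 : G.dist y z = 1 := SimpleGraph.dist_eq_one_iff_adj.2 hyz
      simp only [hyz, h3, if_true]
      rcases (by omega : G.dist x z + 1 = i ∨ G.dist x z = i ∨ G.dist x z = i + 1) with h4 | h4 | h4
      · rw [if_pos h4, if_neg (by omega), ← h4]; simp
      · rw [if_neg (by omega), if_neg (by omega), h4]; simp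
      · rw [if_neg (by omega), if_pos h4, h4]; simp
    · simp [hyz]
  have hd := h.2.2.2.2.2 i (h.2.1 x y) x y rfl
  have h0 := (h.2.2.2.2.2 0 (Nat.zero_le _) y y (by simp)).2
  simp_rw [key, Finset.sum_add_distrib, ← Finset.mul_sum, Finset.sum_sub_distrib, sum_adj_ite]
  rw [hd.1, hd.2, h0, intersectionOp]
  ring

/-- The intersection operator is symmetric with respect to convolution. -/
lemma distConv_intersectionOp (h : IsDistRegular G D b c) (g f : ℕ → ℝ) (x y : V) :
    distConv G (intersectionOp b c g) f x y = distConv G g (intersectionOp b c f) x y := by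
  classical
  simp_rw [distConv, ← h.sum_adj, Finset.mul_sum, Finset.sum_mul]
  rw [Finset.sum_comm]
  refine Finset.sum_congr rfl fun w _ => Finset.sum_congr rfl fun z _ => ?_
  simp [G.adj_comm w z]

lemma intersectionOp_single (h0 : c 0 = 0) (j i : ℕ) :
    intersectionOp b c (Pi.single j 1) i =
      c (j + 1) * (Pi.single (j + 1) 1 : ℕ → ℝ) i +
        ((b 0 : ℝ) - b j - c j) * (Pi.single j 1 : ℕ → ℝ) i +
        b (j - 1) * (if i + 1 = j then 1 else 0) := by
  simp only [intersectionOp, Pi.single_apply]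
  rcases i with _ | i
  · rcases j with _ | _ | j <;> simp [h0]
  · rcases lt_trichotomy i j with hij | rfl | hij
    · rcases (by omega : i + 1 = j ∨ i + 2 = j ∨ i + 2 < j) with rfl | rfl | h3
      · simp
      · simp
      · grind
    · simp [show i + 1 + 1 ≠ i by omega]
    · grind

lemma distConv_add (g₁ g₂ f : ℕ → ℝ) (x y : V) :
    distConv G (g₁ + g₂) f x y = distConv G g₁ f x y + distConv G g₂ f x y := by
  simp [distConv, add_mul, Finset.sum_add_distrib]

lemma distConv_smul (r : ℝ) (g f : ℕ → ℝ) (x y : V) :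
    distConv G (r • g) f x y = r * distConv G g f x y := by
  simp [distConv, mul_assoc, Finset.mul_sum]

lemma distConv_single_zero (h : IsDistRegular G D b c) (f : ℕ → ℝ) (x y : V) :
    distConv G (Pi.single 0 1) f x y = f (G.dist x y) := by
  classical
  rw [distConv, Finset.sum_eq_single x]
  · simp [SimpleGraph.dist_comm]
  · intro z _ hz
    simp [h.1.dist_eq_zero_iff, hz.symm]
  · simp

lemma distConv_single_succ (h : IsDistRegular G D b c) (j : ℕ) (f : ℕ → ℝ) (x y : V) :
    c (j + 1) * distConv G (Pi.single (j + 1) 1) f x y =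
      distConv G (Pi.single j 1) (intersectionOp b c f) x y -
        ((b 0 : ℝ) - b j - c j) * distConv G (Pi.single j 1) f x y -
        b (j - 1) * distConv G (fun i => if i + 1 = j then 1 else 0) f x y := by
  rw [← h.distConv_intersectionOp, ← distConv_smul, ← distConv_smul, ← distConv_smul,
    sub_sub, eq_sub_iff_add_eq, ← distConv_add, ← distConv_add, ← add_assoc]
  congr 1
  funext i
  simp [intersectionOp_single h.2.2.2.1]

/-- The convolution with an indicator depends only on the distance. -/
lemma exists_distConv_single_eq (h : IsDistRegular G D b c) (j : ℕ) :
    ∀ f : ℕ → ℝ, ∃ φ : ℕ → ℝ, ∀ x y : V,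
      distConv G (Pi.single j 1) f x y = φ (G.dist x y) := by
  induction j using Nat.strong_induction_on with
  | _ j ih =>
  intro f
  rcases j with _ | j
  · exact ⟨f, h.distConv_single_zero f⟩
  by_cases hj : j + 1 ≤ D
  · have hc : (c (j + 1) : ℝ) ≠ 0 := by exact_mod_cast (h.c_succ_pos hj).ne'
    obtain ⟨φ₁, h₁⟩ := ih j (by omega) (intersectionOp b c f)
    obtain ⟨φ₂, h₂⟩ := ih j (by omega) f
    obtain ⟨φ₃, h₃⟩ : ∃ φ : ℕ → ℝ, ∀ x y : V,
        distConv G (fun i => if i + 1 = j then 1 else 0) f x y = φ (G.dist x y) := by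
      rcases j with _ | j
      · exact ⟨0, fun x y => by simp [distConv]⟩
      · obtain ⟨φ, hφ⟩ := ih j (by omega) f
        refine ⟨φ, fun x y => ?_⟩
        rw [← hφ]
        congr 1
        funext i
        simp [Pi.single_apply]
    refine ⟨fun i => (c (j + 1) : ℝ)⁻¹ * (φ₁ i - ((b 0 : ℝ) - b j - c j) * φ₂ i -
      b (j - 1) * φ₃ i), fun x y => ?_⟩
    rw [eq_inv_mul_iff_mul_eq₀ hc, h.distConv_single_succ, h₁, h₂, h₃]
  · refine ⟨0, fun x y => Finset.sum_eq_zero fun z _ => ?_⟩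
    have := h.2.1 x z
    simp [show G.dist x z ≠ j + 1 by omega]

lemma sum_single_mul (j : ℕ) (φ : ℕ → ℝ) :
    ∑ x : V, ∑ y : V, (Pi.single j 1 : ℕ → ℝ) (G.dist x y) * φ (G.dist x y) =
      numPairs G j * φ j := by
  simp_rw [numPairs, Finset.sum_mul]
  refine Finset.sum_congr rfl fun x _ => Finset.sum_congr rfl fun y _ => ?_
  by_cases hxy : G.dist x y = j <;> simp [hxy]

/-- Double counting of triangles with prescribed side lengths. -/
lemma numPairs_mul_distConv (h : IsDistRegular G D b c) (i j : ℕ) (f : ℕ → ℝ) {x y : V}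
    (hxy : G.dist x y = i) :
    numPairs G i * distConv G (Pi.single j 1) f x y =
      ∑ u : V, ∑ v : V, (Pi.single j 1 : ℕ → ℝ) (G.dist u v) *
        distConv G (Pi.single i 1) f u v := by
  obtain ⟨φ, hφ⟩ := h.exists_distConv_single_eq j f
  rw [hφ, hxy, ← sum_single_mul]
  simp_rw [← hφ, distConv, Finset.mul_sum]
  refine Finset.sum_congr rfl fun u _ => ?_
  rw [Finset.sum_comm]
  refine Finset.sum_congr rfl fun v _ => Finset.sum_congr rfl fun w _ => ?_
  rw [G.dist_comm (u := w) (v := v)]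
  ring

lemma distConv_single_one (h : IsDistRegular G D b c) (hD : 1 ≤ D) (f : ℕ → ℝ) (x y : V) :
    distConv G (Pi.single 1 1) f x y = intersectionOp b c f (G.dist x y) := by
  have := h.distConv_single_succ 0 f x y
  rw [h.distConv_single_zero] at this
  simpa [h.c_one hD, h.2.2.2.1, show distConv G (fun _ => (0 : ℝ)) f x y = 0 by simp [distConv]]
    using this

lemma numPairs_one_mul_distConv (h : IsDistRegular G D b c) (hD : 1 ≤ D) (j : ℕ) (f : ℕ → ℝ)
    {x y : V} (hxy : G.dist x y = 1) :
    numPairs G 1 * distConv G (Pi.single j 1) f x y =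
      numPairs G j * intersectionOp b c f j := by
  rw [h.numPairs_mul_distConv 1 j f hxy, ← sum_single_mul]
  simp_rw [h.distConv_single_one hD]

lemma c_two_mul_numPairs_two_mul_distConv (h : IsDistRegular G D b c) (hD : 1 ≤ D) (j : ℕ)
    (f : ℕ → ℝ) {x y : V} (hxy : G.dist x y = 2) :
    c 2 * numPairs G 2 * distConv G (Pi.single j 1) f x y =
      numPairs G j * (intersectionOp b c (intersectionOp b c f) j -
        ((b 0 : ℝ) - b 1 - c 1) * intersectionOp b c f j - b 0 * f j) := by
  rw [mul_assoc, h.numPairs_mul_distConv 2 j f hxy, ← sum_single_mul j (fun j =>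
    intersectionOp b c (intersectionOp b c f) j -
        ((b 0 : ℝ) - b 1 - c 1) * intersectionOp b c f j - b 0 * f j)]
  simp_rw [Finset.mul_sum]
  refine Finset.sum_congr rfl fun u _ => Finset.sum_congr rfl fun v _ => ?_
  have h2 := h.distConv_single_succ 1 f u v
  have h0 : (fun i => if i + 1 = 1 then (1 : ℝ) else 0) = Pi.single 0 1 := by
    funext i; simp [Pi.single_apply]
  rw [h0, h.distConv_single_one hD, h.distConv_single_one hD, h.distConv_single_zero] at h2
  rw [mul_left_comm, h2]

lemma distConv_comm (g f : ℕ → ℝ) (x y : V) : distConv G g f x y = distConv G f g y x := by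
  simp [distConv, mul_comm]

lemma numPairs_mul_b (h : IsDistRegular G D b c) (hD : 1 ≤ D) (j : ℕ) :
    numPairs G j * b j = numPairs G (j + 1) * c (j + 1) := by
  obtain ⟨x, y, hxy⟩ := h.exists_dist_eq hD
  have h1 := h.numPairs_one_mul_distConv hD j (Pi.single (j + 1) 1) hxy
  have h2 := h.numPairs_one_mul_distConv hD (j + 1) (Pi.single j 1)
    (SimpleGraph.dist_comm.trans hxy)
  rw [distConv_comm, h1, intersectionOp_single h.2.2.2.1, intersectionOp_single h.2.2.2.1] at h2
  simpa [show j + 1 + 1 ≠ j by omega, show j ≠ j + 1 + 1 by omega] using h2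

/-- For the distances `s, t, u, v` from a vertex to a quadrangle, the sides crossing from level `j`
to level `j + 1` are at least as many as the diagonals crossing it, weighted by the difference of levels. -/
lemma sum_single_mul_single_le (j : ℕ) {s t u v : ℕ} (hst : s ≤ t + 1) (hts : t ≤ s + 1)
    (htu : t ≤ u + 1) (hut : u ≤ t + 1) (huv : u ≤ v + 1) (hvu : v ≤ u + 1)
    (hvs : v ≤ s + 1) (hsv : s ≤ v + 1) (e p q : ℕ → ℕ → ℝ)
    (he : ∀ m n, e m n = (Pi.single j 1 : ℕ → ℝ) m * (Pi.single (j + 1) 1 : ℕ → ℝ) n)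
    (hp : ∀ m n, p m n = (Pi.single j 1 : ℕ → ℝ) m * (Pi.single (j + 2) 1 : ℕ → ℝ) n)
    (hq : ∀ m n, q m n = (Pi.single (j + 1) 1 : ℕ → ℝ) m * (if n + 1 = j then 1 else 0)) :
    (e s u + e u s + e t v + e v t) + 2 * (p s u + p u s + p t v + p v t) +
        2 * (q s u + q u s + q t v + q v t) ≤
      e s t + e t s + e t u + e u t + e u v + e v u + e v s + e s v := by
  have level (n : ℕ) : n + 1 = j ∨ n = j ∨ n = j + 1 ∨ n = j + 2 ∨ n + 1 < j ∨ j + 2 < n := by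
    omega
  simp only [he, hp, hq, Pi.single_apply]
  rcases level s with hs | hs | hs | hs | hs | hs <;>
  rcases level t with ht | ht | ht | ht | ht | ht <;> first | omega | skip
  all_goals
  rcases level u with hu | hu | hu | hu | hu | hu <;> first | omega | skip
  all_goals
  rcases level v with hv | hv | hv | hv | hv | hv <;> first | omega | skip
  all_goals
  simp (disch := omega) only [if_pos, if_neg]
  norm_num

lemma c_sub_b_add_le (h : IsDistRegular G D b c) (hquad : HasQuadrangle G) {j : ℕ}
    (hj : j + 1 ≤ D) :
    (c j : ℝ) - b j + (b 0 + 1 - b 1) ≤ c (j + 1) - b (j + 1) := by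
  obtain ⟨v0, v1, v2, v3, -, h02, -, -, h13, -, a01, a12, a23, a30, n02, n13⟩ := hquad
  have d02 := dist_eq_two h.1 a01 a12 h02 n02
  have d13 := dist_eq_two h.1 a12 a23 h13 n13
  have hD : 1 ≤ D := by omega
  have hc0 := h.2.2.2.1
  have hside {x y : V} (hxy : G.Adj x y) :
      numPairs G 1 * distConv G (Pi.single j 1) (Pi.single (j + 1) 1) x y =
        numPairs G j * b j := by
    rw [h.numPairs_one_mul_distConv hD j _ (SimpleGraph.dist_eq_one_iff_adj.2 hxy),
      intersectionOp_single hc0]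
    simp [show j ≠ j + 1 + 1 by omega]
  have hN : (c 2 : ℝ) * numPairs G 2 = numPairs G 1 * b 1 := by
    rw [h.numPairs_mul_b hD 1, mul_comm]
  have hdiag₁ {x y : V} (hxy : G.dist x y = 2) :
      numPairs G 1 * b 1 * distConv G (Pi.single j 1) (Pi.single (j + 1) 1) x y =
        numPairs G j * b j * ((b 0 - b j - c j) + (b 0 - b (j + 1) - c (j + 1)) -
          (b 0 - b 1 - 1)) := by
    rw [← hN, h.c_two_mul_numPairs_two_mul_distConv hD j _ hxy, h.c_one hD]
    rcases j with _ | j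
    · simp [intersectionOp, hc0]; ring
    · simp (disch := omega) [intersectionOp]; ring
  have hdiag₂ {x y : V} (hxy : G.dist x y = 2) :
      numPairs G 1 * b 1 * distConv G (Pi.single j 1) (Pi.single (j + 2) 1) x y =
        numPairs G j * b j * b (j + 1) := by
    rw [← hN, h.c_two_mul_numPairs_two_mul_distConv hD j _ hxy]
    rcases j with _ | j
    · simp [intersectionOp, hc0]; ring
    · simp (disch := omega) [intersectionOp]; ring
  have hdiag₃ {x y : V} (hxy : G.dist x y = 2) :
      numPairs G 1 * b 1 *
          distConv G (Pi.single (j + 1) 1) (fun i => if i + 1 = j then 1 else 0) x y =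
        numPairs G j * b j * c j := by
    rw [← hN, h.c_two_mul_numPairs_two_mul_distConv hD _ _ hxy, h.numPairs_mul_b hD j]
    rcases j with _ | j
    · simp [intersectionOp, hc0]
    · simp (disch := omega) [intersectionOp, if_neg]; ring
  have hle := Finset.sum_le_sum fun (z : V) (_ : z ∈ Finset.univ) =>
    have near {x y : V} (hxy : G.Adj x y) : G.dist x z ≤ G.dist y z + 1 := by
      simpa only [G.dist_comm (v := z)] using dist_le_add_one_of_adj h.1 z hxy.symm
    sum_single_mul_single_le j (near a01) (near a01.symm) (near a12) (near a12.symm)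
      (near a23) (near a23.symm) (near a30) (near a30.symm) _ _ _
      (fun _ _ => rfl) (fun _ _ => rfl) (fun _ _ => rfl)
  simp only [Finset.sum_add_distrib, ← Finset.mul_sum] at hle
  simp only [distConv] at hside hdiag₁ hdiag₂ hdiag₃
  have hN1 := h.numPairs_pos hD
  have hb1 : (0 : ℝ) < b 1 := by
    exact_mod_cast h.b_pos (j := 1) (by have := h.2.1 v0 v2; omega)
  have hNb : 0 < numPairs G j * b j :=
    mul_pos (h.numPairs_pos (by omega)) (by exact_mod_cast h.b_pos hj)
  have d20 := SimpleGraph.dist_comm.trans d02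
  have d31 := SimpleGraph.dist_comm.trans d13
  have hmul := mul_le_mul_of_nonneg_left hle (mul_pos hN1 hb1).le
  have hscaled : numPairs G j * b j * (4 * ((b 0 - b j - c j) +
      (b 0 - b (j + 1) - c (j + 1)) - (b 0 - b 1 - 1)) + 8 * b (j + 1) + 8 * c j) ≤
      numPairs G j * b j * (8 * b 1) := by
    linarith [hdiag₁ d02, hdiag₁ d20, hdiag₁ d13, hdiag₁ d31, hdiag₂ d02, hdiag₂ d20,
      hdiag₂ d13, hdiag₂ d31, hdiag₃ d02, hdiag₃ d20, hdiag₃ d13, hdiag₃ d31,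
      congrArg (· * (b 1 : ℝ)) (hside a01), congrArg (· * (b 1 : ℝ)) (hside a01.symm),
      congrArg (· * (b 1 : ℝ)) (hside a12), congrArg (· * (b 1 : ℝ)) (hside a12.symm),
      congrArg (· * (b 1 : ℝ)) (hside a23), congrArg (· * (b 1 : ℝ)) (hside a23.symm),
      congrArg (· * (b 1 : ℝ)) (hside a30), congrArg (· * (b 1 : ℝ)) (hside a30.symm)]
  linarith [le_of_mul_le_mul_left hscaled hNb]

lemma b_add_c_le (h : IsDistRegular G D b c) {j : ℕ} (hj : j ≤ D) : b j + c j ≤ b 0 := by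
  classical
  obtain ⟨x, y, hxy⟩ := h.exists_dist_eq hj
  have hsum := h.sum_adj (Pi.single j 1) x y
  rw [hxy, intersectionOp_single h.2.2.2.1] at hsum
  have hnn : (0 : ℝ) ≤ ∑ z, if G.Adj y z then (Pi.single j 1 : ℕ → ℝ) (G.dist x z) else 0 :=
    Finset.sum_nonneg fun z _ => by
      rw [Pi.single_apply]
      split_ifs <;> norm_num
  simp only [Pi.single_eq_same, Pi.single_apply, show j ≠ j + 1 by omega,
    show j + 1 ≠ j by omega, if_false] at hsum
  have : (b j : ℝ) + c j ≤ b 0 := by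
    simp only [Pi.single_apply] at hnn
    linarith
  exact_mod_cast this

lemma mul_le_c_sub_b (h : IsDistRegular G D b c) (hquad : HasQuadrangle G) {j : ℕ}
    (hj : j ≤ D) : (j : ℝ) * (b 0 + 1 - b 1) ≤ c j - b j + b 0 := by
  induction j with
  | zero => simp
  | succ j ih =>
    have h1 := ih (by omega)
    have h2 := h.c_sub_b_add_le hquad hj
    push_cast
    linarith

end IsDistRegular

/-- If a distance-regular graph with valency `k = b 0 ≥ 3` and diameter `D` contains a
quadrangle, then `D ≤ 2k / (k + 1 - b 1)`, and hence `D ≤ b 1 + 1`. -/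
theorem diameter_bound_of_quadrangle (V : Type) [Fintype V] (G : SimpleGraph V)
    (D : ℕ) (b c : ℕ → ℕ) (h : IsDistRegular G D b c) (hk : 3 ≤ b 0)
    (hquad : HasQuadrangle G) :
    (D : ℝ) ≤ 2 * (b 0 : ℝ) / ((b 0 : ℝ) + 1 - (b 1 : ℝ)) ∧ D ≤ b 1 + 1 := by
  have hD : 2 ≤ D := by
    obtain ⟨v0, v1, v2, v3, -, h02, -, -, -, -, a01, a12, -, -, n02, -⟩ := hquad
    exact (IsDistRegular.dist_eq_two h.1 a01 a12 h02 n02).symm.le.trans (h.2.1 v0 v2)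
  have h1 : (b 1 : ℝ) + 1 ≤ b 0 := by
    have := h.b_add_c_le (j := 1) (by omega)
    rw [h.c_one (by omega)] at this
    exact_mod_cast this
  have h2 : (1 : ℝ) ≤ b 1 := by exact_mod_cast h.b_pos (j := 1) hD
  have h3 : (b D : ℝ) = 0 := by exact_mod_cast h.2.2.2.2.1
  have h4 : (b D : ℝ) + c D ≤ b 0 := by exact_mod_cast h.b_add_c_le le_rfl
  have h5 := h.mul_le_c_sub_b hquad le_rfl
  have hpos : (0 : ℝ) < b 0 + 1 - b 1 := by linarith
  have hbound : (D : ℝ) ≤ 2 * (b 0 : ℝ) / ((b 0 : ℝ) + 1 - (b 1 : ℝ)) := by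
    rw [le_div_iff₀ hpos]
    linarith
  refine ⟨hbound, ?_⟩
  have : (D : ℝ) ≤ b 1 + 1 := hbound.trans (by
    rw [div_le_iff₀ hpos]
    nlinarith [mul_nonneg (sub_nonneg.2 h2) (sub_nonneg.2 h1)])
  exact_mod_cast this
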